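/- arXiv:2002.12406 — 2 statements merged into one kernel-verified Lean document; each statement's English description precedes it below -/
import Mathlib

section
/- Let X and Z be nonempty finite types, p a probability mass function on X with p x > 0, e : X → Z → ℝ an encoder with e x z > 0 and ∑_z e x z = 1 for each x, and d : Z → X → ℝ a decoder with d z x > 0 and ∑_x d z x = 1 for each z. Define the encoder marginal ē z = ∑_x p x · e x z, the mutual information I = ∑_x p x · ∑_z e x z · log(e x z / ē z), the entropy H = ∑_x p x·(-log p x), and the distortion D = ∑_x p x · ∑_z e x z·(-log (d z x)). Then H - D ≤ I. -/
open Real Finset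

/-- The pointwise form of Gibbs' inequality. -/
theorem sub_le_mul_log_div {a b : ℝ} (ha : 0 < a) (hb : 0 < b) :
    a - b ≤ a * Real.log (a / b) := by
  have h := mul_le_mul_of_nonneg_left (Real.one_sub_inv_le_log_of_pos (div_pos ha hb)) ha.le
  rwa [inv_div, mul_sub, mul_one, mul_div_cancel₀ _ ha.ne'] at h

/-- The left inequality of the rate–distortion sandwich: `H - D ≤ I`, where `H` is
entropy, `D` distortion and `I` mutual information of data and latent code. -/
theorem entropy_sub_distortion_le_mutualInformation {X Z : Type*}
    [Fintype X] [Nonempty X] [Fintype Z] [Nonempty Z]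
    (p : X → ℝ) (hp : ∀ x, 0 < p x) (hp1 : ∑ x, p x = 1)
    (e : X → Z → ℝ) (he : ∀ x z, 0 < e x z) (he1 : ∀ x, ∑ z, e x z = 1)
    (d : Z → X → ℝ) (hd : ∀ z x, 0 < d z x) (hd1 : ∀ z, ∑ x, d z x = 1) :
    (∑ x, p x * (-Real.log (p x))) -
      (∑ x, p x * ∑ z, e x z * (-Real.log (d z x))) ≤
      ∑ x, p x * ∑ z, e x z * Real.log (e x z / ∑ x', p x' * e x' z) := by
  set m : Z → ℝ := fun z ↦ ∑ x, p x * e x z with hm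
  have hm_pos (z : Z) : 0 < m z := sum_pos (fun x _ ↦ mul_pos (hp x) (he x z)) univ_nonempty
  have h_joint : ∑ x, ∑ z, p x * e x z = 1 := by simp [← mul_sum, he1, hp1]
  have h_model : ∑ x, ∑ z, m z * d z x = 1 := by
    rw [sum_comm]
    simp only [← mul_sum, hd1, mul_one]
    rw [hm, sum_comm, h_joint]
  have h_gibbs : 0 ≤ ∑ x, ∑ z, p x * e x z * Real.log (p x * e x z / (m z * d z x)) := calc
    (0 : ℝ) = ∑ x, ∑ z, (p x * e x z - m z * d z x) := by
      simp only [sum_sub_distrib, h_joint, h_model, sub_self]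
    _ ≤ _ := sum_le_sum fun x _ ↦ sum_le_sum fun z _ ↦
      sub_le_mul_log_div (mul_pos (hp x) (he x z)) (mul_pos (hm_pos z) (hd z x))
  have h_entropy (x : X) : p x * (-Real.log (p x)) = ∑ z, p x * e x z * (-Real.log (p x)) := by
    rw [← sum_mul, ← mul_sum, he1, mul_one]
  rw [← sub_nonneg]
  refine h_gibbs.trans_eq ?_
  simp only [h_entropy, mul_sum, ← sum_sub_distrib]
  refine sum_congr rfl fun x _ ↦ sum_congr rfl fun z _ ↦ ?_
  change _ = p x * (e x z * Real.log (e x z / m z)) - _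
  rw [Real.log_div (mul_pos (hp x) (he x z)).ne' (mul_pos (hm_pos z) (hd z x)).ne',
    Real.log_mul (hp x).ne' (he x z).ne', Real.log_mul (hm_pos z).ne' (hd z x).ne',
    Real.log_div (he x z).ne' (hm_pos z).ne']
  ring
end

section
/- Let F : ℝ × ℝ → ℝ be twice continuously differentiable, let α ∈ ℝ, and let λ, γ : ℝ → ℝ be differentiable curves satisfying the iso-classification dynamics λ'(t) = -α · (∂²F/∂γ²)(λ(t), γ(t)) and γ'(t) = α · (∂²F/∂λ∂γ)(λ(t), γ(t)). Define D(t) = (∂F/∂λ)(λ(t), γ(t)), C(t) = (∂F/∂γ)(λ(t), γ(t)), and R(t) = F(λ(t), γ(t)) - λ(t)·D(t) - γ(t)·C(t). Then R'(t) = -λ(t)·D'(t) = α·λ(t)·det(Hess F(λ(t), γ(t))) for all t; in particular, if α > 0, λ(t) > 0 and the Hessian of F is negative definite at (λ(t), γ(t)), then R'(t) > 0. -/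
open Matrix

/-- `∂F/∂λ`. -/
noncomputable def pdL (F : ℝ × ℝ → ℝ) (a b : ℝ) : ℝ := deriv (fun x => F (x, b)) a
/-- `∂F/∂γ`. -/
noncomputable def pdG (F : ℝ × ℝ → ℝ) (a b : ℝ) : ℝ := deriv (fun y => F (a, y)) b
/-- `∂²F/∂λ²`. -/
noncomputable def pdLL (F : ℝ × ℝ → ℝ) (a b : ℝ) : ℝ := deriv (fun x => pdL F x b) a
/-- `∂²F/∂γ²`. -/
noncomputable def pdGG (F : ℝ × ℝ → ℝ) (a b : ℝ) : ℝ := deriv (fun y => pdG F a y) b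
/-- `∂²F/∂λ∂γ`. -/
noncomputable def pdLG (F : ℝ × ℝ → ℝ) (a b : ℝ) : ℝ := deriv (fun x => pdG F x b) a
/-- `∂²F/∂γ∂λ`. -/
noncomputable def pdGL (F : ℝ × ℝ → ℝ) (a b : ℝ) : ℝ := deriv (fun y => pdL F a y) b

/-- The Hessian of `F : ℝ × ℝ → ℝ` at `(a, b)`. -/
noncomputable def hessF (F : ℝ × ℝ → ℝ) (a b : ℝ) : Matrix (Fin 2) (Fin 2) ℝ :=
  !![pdLL F a b, pdLG F a b; pdGL F a b, pdGG F a b]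

/-- A real matrix is negative definite if its quadratic form is strictly negative
on nonzero vectors. -/
def NegDefMat {n : Type*} [Fintype n] (M : Matrix n n ℝ) : Prop :=
  ∀ v : n → ℝ, v ≠ 0 → v ⬝ᵥ M.mulVec v < 0

theorem deriv_fst_slice {f : ℝ × ℝ → ℝ} {a b : ℝ} (hf : DifferentiableAt ℝ f (a, b)) :
    deriv (fun x => f (x, b)) a = fderiv ℝ f (a, b) (1, 0) :=
  (hf.hasFDerivAt.comp_hasDerivAt a ((hasDerivAt_id a).prodMk (hasDerivAt_const a b))).deriv

theorem deriv_snd_slice {f : ℝ × ℝ → ℝ} {a b : ℝ} (hf : DifferentiableAt ℝ f (a, b)) :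
    deriv (fun y => f (a, y)) b = fderiv ℝ f (a, b) (0, 1) :=
  (hf.hasFDerivAt.comp_hasDerivAt b ((hasDerivAt_const b a).prodMk (hasDerivAt_id b))).deriv

/-- The chain rule along a plane curve, in terms of partial derivatives. -/
theorem hasDerivAt_comp_curve {f : ℝ × ℝ → ℝ} {u v : ℝ → ℝ} {u' v' t : ℝ}
    (hf : DifferentiableAt ℝ f (u t, v t)) (hu : HasDerivAt u u' t) (hv : HasDerivAt v v' t) :
    HasDerivAt (fun s => f (u s, v s))
      (deriv (fun x => f (x, v t)) (u t) * u' + deriv (fun y => f (u t, y)) (v t) * v') t := by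
  have h : HasDerivAt (fun s => f (u s, v s)) (fderiv ℝ f (u t, v t) (u', v')) t :=
    HasFDerivAt.comp_hasDerivAt t (f := fun s => (u s, v s)) hf.hasFDerivAt (hu.prodMk hv)
  have hsplit : ((u', v') : ℝ × ℝ) = u' • ((1, 0) : ℝ × ℝ) + v' • ((0, 1) : ℝ × ℝ) := by simp
  rw [deriv_fst_slice hf, deriv_snd_slice hf]
  rw [hsplit, map_add, map_smul, map_smul, smul_eq_mul, smul_eq_mul] at h
  convert h using 1
  ring

theorem differentiable_fderiv_apply {F : ℝ × ℝ → ℝ} (hF : ContDiff ℝ 2 F) (v : ℝ × ℝ) :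
    Differentiable ℝ (fun p => fderiv ℝ F p v) :=
  ((hF.fderiv_right (m := 1) (by norm_num)).differentiable (by norm_num)).clm_apply
    (differentiable_const v)

theorem differentiable_pdL {F : ℝ × ℝ → ℝ} (hF : ContDiff ℝ 2 F) :
    Differentiable ℝ (fun p : ℝ × ℝ => pdL F p.1 p.2) := by
  have h : (fun p : ℝ × ℝ => pdL F p.1 p.2) = fun p => fderiv ℝ F p (1, 0) :=
    funext fun p => deriv_fst_slice (hF.differentiable (by norm_num) (p.1, p.2))
  exact h ▸ differentiable_fderiv_apply hF (1, 0)

theorem differentiable_pdG {F : ℝ × ℝ → ℝ} (hF : ContDiff ℝ 2 F) :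
    Differentiable ℝ (fun p : ℝ × ℝ => pdG F p.1 p.2) := by
  have h : (fun p : ℝ × ℝ => pdG F p.1 p.2) = fun p => fderiv ℝ F p (0, 1) :=
    funext fun p => deriv_snd_slice (hF.differentiable (by norm_num) (p.1, p.2))
  exact h ▸ differentiable_fderiv_apply hF (0, 1)

/-- A negative definite `2 × 2` matrix, symmetric or not, has positive determinant. -/
theorem NegDefMat.det_pos {M : Matrix (Fin 2) (Fin 2) ℝ} (hM : NegDefMat M) : 0 < M.det := by
  have h₀ := hM ![1, 0] (fun h => by simpa using congrFun h 0)
  simp only [dotProduct, mulVec, Fin.sum_univ_two, cons_val_zero, cons_val_one] at h₀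
  have hneg : M 0 0 < 0 := by linarith
  have h₁ := hM ![-(M 0 1 + M 1 0), 2 * M 0 0] (fun h => by
    have := congrFun h 1
    simp at this
    exact hneg.ne this)
  simp only [dotProduct, mulVec, Fin.sum_univ_two, cons_val_zero, cons_val_one] at h₁
  rw [det_fin_two]
  have hprod : M 0 0 * (4 * (M 0 0 * M 1 1) - (M 0 1 + M 1 0) ^ 2) < 0 := by
    linear_combination h₁
  have hdisc := pos_of_mul_neg_right hprod hneg.le
  nlinarith [sq_nonneg (M 0 1 - M 1 0)]

/-- Rate–distortion trade-off along the iso-classification dynamics: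
`Ṙ = -λ Ḋ = α λ det(Hess F)`, which is positive if `α > 0`, `λ > 0` and `Hess F ≺ 0`. -/
theorem rate_distortion_tradeoff (F : ℝ × ℝ → ℝ) (hF : ContDiff ℝ 2 F)
    (α : ℝ) (l g : ℝ → ℝ)
    (hl : ∀ t, HasDerivAt l (-α * pdGG F (l t) (g t)) t)
    (hg : ∀ t, HasDerivAt g (α * pdLG F (l t) (g t)) t)
    (D C R : ℝ → ℝ)
    (hD : D = fun s => pdL F (l s) (g s))
    (hC : C = fun s => pdG F (l s) (g s))
    (hR : R = fun s => F (l s, g s) - l s * D s - g s * C s) :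
    ∀ t, deriv R t = -(l t) * deriv D t ∧
      deriv R t = α * l t * (hessF F (l t) (g t)).det ∧
      (0 < α → 0 < l t → NegDefMat (hessF F (l t) (g t)) → 0 < deriv R t) := by
  intro t
  have hD' : HasDerivAt D (-α * (hessF F (l t) (g t)).det) t := by
    have h := hasDerivAt_comp_curve (differentiable_pdL hF (l t, g t)) (hl t) (hg t)
    rw [hD]
    convert h using 1
    simp only [hessF, det_fin_two_of, pdLL, pdGL]
    ring
  have hC' : HasDerivAt C 0 t := by
    have h := hasDerivAt_comp_curve (differentiable_pdG hF (l t, g t)) (hl t) (hg t)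
    rw [hC]
    convert h using 1
    simp only [pdLG, pdGG]
    ring
  have hR' : HasDerivAt R (α * l t * (hessF F (l t) (g t)).det) t := by
    have h := hasDerivAt_comp_curve (hF.differentiable (by norm_num) (l t, g t)) (hl t) (hg t)
    rw [hR]
    refine ((h.sub ((hl t).mul hD')).sub ((hg t).mul hC')).congr_deriv ?_
    simp only [hD, hC, pdL, pdG]
    ring
  rw [hR'.deriv, hD'.deriv]
  exact ⟨by ring, rfl, fun hα hlt hM => mul_pos (mul_pos hα hlt) hM.det_pos⟩
end
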